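/- Let C be an irreducible plane curve of degree n with singular points of multiplicities m_1, ..., m_k. Then the quantity (n−1)(n−2)/2 − Σ m_i(m_i−1)/2 is nonnegative. -/

import Mathlib

open MvPolynomial

variable {k : Type} [Field k]

/-- Iterated partial derivatives along a list of variable indices. -/
noncomputable def pderivList {n : ℕ} (s : List (Fin n)) (F : MvPolynomial (Fin n) k) :
    MvPolynomial (Fin n) k :=
  s.foldr (fun i G => pderiv i G) F

/-- The `m`-th directional derivative of `F` at `v` in direction `w`
(`m!` times the degree-`m` Taylor form). -/
noncomputable def dirDeriv {n : ℕ} (F : MvPolynomial (Fin n) k)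
    (v w : Fin n → k) (m : ℕ) : k :=
  ∑ s : Fin m → Fin n, eval v (pderivList (List.ofFn s) F) * ∏ j, w (s j)

/-- `F` has multiplicity (exactly) `m` at the point `v`: all partial derivatives of
order `< m` vanish at `v`, while some order-`m` derivative does not. -/
def HasMultiplicityAt {n : ℕ} (F : MvPolynomial (Fin n) k) (v : Fin n → k) (m : ℕ) : Prop :=
  (∀ s : List (Fin n), s.length < m → eval v (pderivList s F) = 0) ∧
    ∃ s : List (Fin n), s.length = m ∧ eval v (pderivList s F) ≠ 0

/-- A singular point of the projective plane curve `F = 0`. -/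
def IsSingularAt (F : MvPolynomial (Fin 3) k) (v : Fin 3 → k) : Prop :=
  v ≠ 0 ∧ eval v F = 0 ∧ ∀ i, eval v (pderiv i F) = 0

/-- A node (ordinary double point): multiplicity two with two distinct tangent
directions, i.e. the degree-2 tangent cone is not (a multiple of) a square of a linear form. -/
def IsNodeAt (F : MvPolynomial (Fin 3) k) (v : Fin 3 → k) : Prop :=
  v ≠ 0 ∧ eval v F = 0 ∧ HasMultiplicityAt F v 2 ∧
    ¬ ∃ (c : k) (l : Fin 3 → k), ∀ w : Fin 3 → k,
        dirDeriv F v w 2 = c * (∑ i, l i * w i) ^ 2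

/-- An ordinary point of multiplicity `m`: the degree-`m` tangent cone factors into `m`
pairwise distinct linear forms. -/
def IsOrdinaryAt (F : MvPolynomial (Fin 3) k) (v : Fin 3 → k) (m : ℕ) : Prop :=
  HasMultiplicityAt F v m ∧
    ∃ (c : k) (L : Fin m → (Fin 3 → k)), c ≠ 0 ∧
      (∀ i j, i ≠ j → ¬ ∃ t : k, L j = t • L i) ∧
      ∀ w : Fin 3 → k, dirDeriv F v w m = c * ∏ i, (∑ j, L i j * w j)

/-- An (irreducible) plane algebraic curve of degree `n` in `ℙ²`. -/
structure PlaneCurve (k : Type) [Field k] where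
  n : ℕ
  F : MvPolynomial (Fin 3) k
  homog : F.IsHomogeneous n
  irred : Irreducible F

/-- Birational equivalence of the projective curves `F = 0` and `G = 0`, expressed by a
pair of mutually inverse rational maps given by homogeneous polynomial triples. -/
def BirEquiv (F G : MvPolynomial (Fin 3) k) : Prop :=
  ∃ φ ψ : Fin 3 → MvPolynomial (Fin 3) k,
    (∃ d, ∀ i, (φ i).IsHomogeneous d) ∧
    (∃ e, ∀ i, (ψ i).IsHomogeneous e) ∧
    bind₁ φ G ∈ Ideal.span {F} ∧
    bind₁ ψ F ∈ Ideal.span {G} ∧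
    (∃ lam : MvPolynomial (Fin 3) k, lam ∉ Ideal.span {F} ∧
      ∀ i, bind₁ φ (ψ i) - lam * X i ∈ Ideal.span {F}) ∧
    (∃ mu : MvPolynomial (Fin 3) k, mu ∉ Ideal.span {G} ∧
      ∀ i, bind₁ ψ (φ i) - mu * X i ∈ Ideal.span {G})

/-- Substitution of the affine plane `v + x u + y w` with `u = (1,0,-τ²)`, `w = (0,1,-τ)`. -/
noncomputable def locMap (τ : k) (v : Fin 3 → k) :
    MvPolynomial (Fin 3) k →ₐ[k] MvPolynomial (Fin 2) k :=
  aeval ![C (v 0) + X 0, C (v 1) + X 1, C (v 2) - C τ * X 1 - C (τ ^ 2) * X 0]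

/-- Index set for jets of order `< N` in two variables. -/
abbrev JIdx (N : ℕ) : Type := {p : Fin 2 →₀ ℕ // p ∈ (Finset.range N).biUnion
  (fun a => (Finset.univ : Finset (Fin 2)).finsuppAntidiag a)}

theorem mem_jidx (N : ℕ) (p : Fin 2 →₀ ℕ) :
    (p ∈ (Finset.range N).biUnion
      (fun a => (Finset.univ : Finset (Fin 2)).finsuppAntidiag a)) ↔ p.degree < N := by
  simp [Finset.mem_finsuppAntidiag, Finsupp.degree_eq_sum]

theorem two_mul_card_jidx (N : ℕ) : 2 * Fintype.card (JIdx N) = N * (N + 1) := by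
  rw [Fintype.card_coe, Finset.card_biUnion]
  · simp only [Finset.card_finsuppAntidiag_nat_eq_choose]
    induction N with
    | zero => simp
    | succ n ih =>
      rw [Finset.sum_range_succ, mul_add, ih]
      have : (Finset.univ : Finset (Fin 2)).card + n - 1 = n + 1 := by simp; omega
      rw [this]
      simp
      ring
  · intro a _ b _ hab
    rw [Function.onFun, Finset.disjoint_left]
    intro p hp hq
    simp [Finset.mem_finsuppAntidiag] at hp hq
    omega

/-- The jet map. -/
noncomputable def jet (τ : k) (v : Fin 3 → k) (N : ℕ) :
    MvPolynomial (Fin 3) k →ₗ[k] (JIdx N → k) :=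
  (LinearMap.pi fun p : JIdx N => lcoeff k p.1) ∘ₗ (locMap τ v).toLinearMap

theorem jet_eq_zero_iff (τ : k) (v : Fin 3 → k) (N : ℕ) (H : MvPolynomial (Fin 3) k) :
    jet τ v N H = 0 ↔ locMap τ v H ∈ idealOfVars (Fin 2) k ^ N := by
  rw [mem_pow_idealOfVars_iff']
  constructor
  · intro h x hx
    have := congrFun h ⟨x, (mem_jidx N x).2 hx⟩
    simpa [jet, lcoeff] using this
  · intro h
    funext p
    have := h p.1 ((mem_jidx N p.1).1 p.2)
    simpa [jet, lcoeff] using this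

theorem locMap_surjective (τ : k) (v : Fin 3 → k) : Function.Surjective (locMap τ v) := by
  intro T
  refine ⟨aeval ![X 0 - C (v 0), X 1 - C (v 1)] T, ?_⟩
  have : (locMap τ v).comp (aeval ![X 0 - C (v 0), X 1 - C (v 1)]) =
      AlgHom.id k (MvPolynomial (Fin 2) k) := by
    apply MvPolynomial.algHom_ext
    intro i
    fin_cases i <;> simp [locMap, ← algebraMap_eq]
  exact congrArg (fun f => f T) this

theorem jet_surjective (τ : k) (v : Fin 3 → k) (N : ℕ) : Function.Surjective (jet τ v N) := by
  intro c
  obtain ⟨H, hH⟩ := locMap_surjective τ v (∑ p : JIdx N, monomial p.1 (c p))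
  refine ⟨H, ?_⟩
  funext q
  classical
  simp only [jet, LinearMap.comp_apply, AlgHom.toLinearMap_apply, hH, LinearMap.pi_apply, lcoeff_apply,
    coeff_sum, coeff_monomial]
  rw [Finset.sum_eq_single q]
  · simp
  · intro b _ hb
    rw [if_neg]
    intro h
    exact hb (Subtype.ext h)
  · simp

/-- Value of the linear form. -/
def lval (τ : k) (v : Fin 3 → k) : k := v 2 + τ * v 1 + τ ^ 2 * v 0

/-- The linear form. -/
noncomputable def lform (τ : k) : MvPolynomial (Fin 3) k := X 2 + C τ * X 1 + C (τ ^ 2) * X 0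

theorem lform_homog (τ : k) : (lform τ).IsHomogeneous 1 := by
  unfold lform
  exact ((isHomogeneous_X _ _).add (isHomogeneous_C_mul_X _ _)).add (isHomogeneous_C_mul_X _ _)

theorem locMap_lform (τ : k) (v : Fin 3 → k) : locMap τ v (lform τ) = C (lval τ v) := by
  simp [locMap, lform, lval, algHom_C]
  ring

theorem constCoeff_locMap (τ : k) (v : Fin 3 → k) (H : MvPolynomial (Fin 3) k) :
    constantCoeff (locMap τ v H) = eval v H := by
  have : (constantCoeff : MvPolynomial (Fin 2) k →+* k).comp (locMap τ v).toRingHom = eval v := by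
    apply MvPolynomial.ringHom_ext
    · intro r; simp
    · intro i
      fin_cases i <;> simp [locMap]
  exact congrArg (fun f => f H) this

theorem finrank_homog (d : ℕ) :
    2 * Module.finrank k (homogeneousSubmodule (Fin 3) k d) = (d + 1) * (d + 2) := by
  have h1 : Module.finrank k (homogeneousSubmodule (Fin 3) k d) =
      ((Finset.univ : Finset (Fin 3)).finsuppAntidiag d).card := by
    rw [homogeneousSubmodule_eq_finsupp_supported]
    have hs : {x : Fin 3 →₀ ℕ | x.degree = d} =
      (((Finset.univ : Finset (Fin 3)).finsuppAntidiag d : Finset _) : Set (Fin 3 →₀ ℕ)) := by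
      ext x; simp [Finset.mem_finsuppAntidiag, Finsupp.degree_eq_sum]
    rw [hs]
    have e := AddMonoidAlgebra.supportedEquivFinsupp (R := k) (S := k)
      (((Finset.univ : Finset (Fin 3)).finsuppAntidiag d : Finset _) : Set (Fin 3 →₀ ℕ))
    have := e.finrank_eq
    rw [Module.finrank_finsupp_self] at this
    simpa using this
  rw [h1, Finset.card_finsuppAntidiag_nat_eq_choose]
  have : (Finset.univ : Finset (Fin 3)).card + d - 1 = d + 2 := by simp; omega
  rw [this, Nat.choose_symm_add, Nat.choose_two_right]
  have := Nat.even_mul_pred_self (d + 2)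
  rw [Nat.mul_div_cancel' this.two_dvd]
  simp; ring

instance (d : ℕ) : Module.Finite k (homogeneousSubmodule (Fin 3) k d) :=
  Module.Finite.iff_fg.2 (homogeneousSubmodule_fg _ _ d)

theorem pderiv_zero_locMap (τ : k) (v : Fin 3 → k) (F : MvPolynomial (Fin 3) k) :
    pderiv 0 (locMap τ v F) =
      locMap τ v (pderiv 0 F) - C (τ ^ 2) * locMap τ v (pderiv 2 F) := by
  induction F using MvPolynomial.induction_on with
  | C a => simp [algHom_C]
  | add p q hp hq => simp only [map_add, hp, hq]; ring
  | mul_X p j hp =>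
    simp only [map_mul, map_add, pderiv_mul, hp]
    fin_cases j
    · have h2 : pderiv (2 : Fin 3) (X (0 : Fin 3) : MvPolynomial (Fin 3) k) = 0 :=
        pderiv_X_of_ne (by decide)
      have h3 : pderiv (0 : Fin 2) (X (1 : Fin 2) : MvPolynomial (Fin 2) k) = 0 :=
        pderiv_X_of_ne (by decide)
      simp [locMap, h2]; ring
    · have h2 : pderiv (2 : Fin 3) (X (1 : Fin 3) : MvPolynomial (Fin 3) k) = 0 :=
        pderiv_X_of_ne (by decide)
      have h0 : pderiv (0 : Fin 3) (X (1 : Fin 3) : MvPolynomial (Fin 3) k) = 0 :=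
        pderiv_X_of_ne (by decide)
      have h3 : pderiv (0 : Fin 2) (X (1 : Fin 2) : MvPolynomial (Fin 2) k) = 0 :=
        pderiv_X_of_ne (by decide)
      simp [locMap, h2, h0, h3]; ring
    · have h0 : pderiv (0 : Fin 3) (X (2 : Fin 3) : MvPolynomial (Fin 3) k) = 0 :=
        pderiv_X_of_ne (by decide)
      have h3 : pderiv (0 : Fin 2) (X (1 : Fin 2) : MvPolynomial (Fin 2) k) = 0 :=
        pderiv_X_of_ne (by decide)
      have h4 : pderiv (0 : Fin 2) (C τ ^ 2 : MvPolynomial (Fin 2) k) = 0 := by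
        rw [← C_pow, pderiv_C]
      simp [locMap, h0, h3, h4]; ring

theorem pderiv_one_locMap (τ : k) (v : Fin 3 → k) (F : MvPolynomial (Fin 3) k) :
    pderiv 1 (locMap τ v F) =
      locMap τ v (pderiv 1 F) - C τ * locMap τ v (pderiv 2 F) := by
  induction F using MvPolynomial.induction_on with
  | C a => simp [algHom_C]
  | add p q hp hq => simp only [map_add, hp, hq]; ring
  | mul_X p j hp =>
    simp only [map_mul, map_add, pderiv_mul, hp]
    have h3 : pderiv (1 : Fin 2) (X (0 : Fin 2) : MvPolynomial (Fin 2) k) = 0 :=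
      pderiv_X_of_ne (by decide)
    fin_cases j
    · have h2 : pderiv (2 : Fin 3) (X (0 : Fin 3) : MvPolynomial (Fin 3) k) = 0 :=
        pderiv_X_of_ne (by decide)
      have h0 : pderiv (1 : Fin 3) (X (0 : Fin 3) : MvPolynomial (Fin 3) k) = 0 :=
        pderiv_X_of_ne (by decide)
      simp [locMap, h2, h0, h3]; ring
    · have h2 : pderiv (2 : Fin 3) (X (1 : Fin 3) : MvPolynomial (Fin 3) k) = 0 :=
        pderiv_X_of_ne (by decide)
      simp [locMap, h2]; ring
    · have h0 : pderiv (1 : Fin 3) (X (2 : Fin 3) : MvPolynomial (Fin 3) k) = 0 :=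
        pderiv_X_of_ne (by decide)
      have h4 : pderiv (1 : Fin 2) (C τ ^ 2 : MvPolynomial (Fin 2) k) = 0 := by
        rw [← C_pow, pderiv_C]
      simp [locMap, h0, h3, h4]; ring

theorem mem_pow_succ_of_pderiv [CharZero k] (m : ℕ) (g : MvPolynomial (Fin 2) k)
    (h0 : constantCoeff g = 0) (h : ∀ i, pderiv i g ∈ idealOfVars (Fin 2) k ^ m) :
    g ∈ idealOfVars (Fin 2) k ^ (m + 1) := by
  rw [mem_pow_idealOfVars_iff']
  intro x hx
  by_cases hx0 : x = 0
  · subst hx0; exact h0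
  · obtain ⟨i, hi⟩ := Finsupp.ne_iff.1 hx0
    have hle : Finsupp.single i 1 ≤ x := by
      rw [Finsupp.single_le_iff]
      exact Nat.one_le_iff_ne_zero.2 hi
    obtain ⟨y, rfl⟩ := exists_add_of_le hle
    have := (mem_pow_idealOfVars_iff' m _).1 (h i) y (by
      rw [map_add, Finsupp.degree_single] at hx; omega)
    rw [coeff_pderiv, add_comm y] at this
    rcases mul_eq_zero.1 this with h | h
    · exact h
    · exact absurd h (Nat.cast_add_one_ne_zero _)

theorem locMap_mem_pow [CharZero k] (τ : k) (v : Fin 3 → k) (m : ℕ) :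
    ∀ F : MvPolynomial (Fin 3) k,
      (∀ s : List (Fin 3), s.length < m → eval v (pderivList s F) = 0) →
      locMap τ v F ∈ idealOfVars (Fin 2) k ^ m := by
  induction m with
  | zero => intro F _; simp
  | succ m ih =>
    intro F hF
    have hd : ∀ i, locMap τ v (pderiv i F) ∈ idealOfVars (Fin 2) k ^ m := by
      intro i
      apply ih
      intro s hs
      have := hF (s ++ [i]) (by simp; omega)
      simpa [pderivList, List.foldr_append] using this
    apply mem_pow_succ_of_pderiv
    · rw [constCoeff_locMap]
      simpa [pderivList] using hF [] (by simp)
    · intro i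
      fin_cases i
      · show pderiv 0 (locMap τ v F) ∈ _
        rw [pderiv_zero_locMap]
        exact Ideal.sub_mem _ (hd 0) (Ideal.mul_mem_left _ _ (hd 2))
      · show pderiv 1 (locMap τ v F) ∈ _
        rw [pderiv_one_locMap]
        exact Ideal.sub_mem _ (hd 1) (Ideal.mul_mem_left _ _ (hd 2))

theorem mem_idealOfVars_iff_constCoeff (g : MvPolynomial (Fin 2) k) :
    g ∈ idealOfVars (Fin 2) k ↔ constantCoeff g = 0 := by
  have := mem_pow_idealOfVars_iff' (R := k) (σ := Fin 2) 1 g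
  rw [pow_one] at this
  rw [this]
  constructor
  · intro h; exact h 0 (by simp)
  · intro h x hx
    have : x = 0 := by
      rw [← Finsupp.degree_eq_zero_iff]; omega
    subst this; exact h

/-- Interpolation (not yet homogeneous). -/
theorem jets_surjective_aux {ι : Type} [Fintype ι] (τ : k) (Q : ι → Fin 3 → k)
    (hQ : Function.Injective Q) (N : ι → ℕ) (c : ∀ i, JIdx (N i) → k) :
    ∃ H : MvPolynomial (Fin 3) k, ∀ i, jet τ (Q i) (N i) H = c i := by
  choose t ht using fun i => jet_surjective τ (Q i) (N i) (c i)
  let M : ι → Ideal (MvPolynomial (Fin 3) k) := fun i => RingHom.ker (eval (Q i))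
  have hsurj : ∀ i, Function.Surjective (eval (Q i) : MvPolynomial (Fin 3) k →+* k) :=
    fun i a => ⟨C a, by simp⟩
  have hmax : ∀ i, (M i).IsMaximal := fun i => RingHom.ker_isMaximal_of_surjective _ (hsurj i)
  have hcop : Pairwise (Function.onFun IsCoprime fun i => M i ^ N i) := by
    intro i j hij
    apply IsCoprime.pow
    have := hmax i
    have := hmax j
    apply Ideal.isCoprime_of_isMaximal
    intro h
    apply hij
    apply hQ
    funext l
    have : (X l - C (Q i l) : MvPolynomial (Fin 3) k) ∈ M j := by
      rw [← h]; simp [M, RingHom.mem_ker]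
    simp [M, RingHom.mem_ker, sub_eq_zero] at this
    exact this.symm
  obtain ⟨H, hH⟩ := Ideal.exists_forall_sub_mem_ideal hcop t
  refine ⟨H, fun i => ?_⟩
  rw [← ht i, ← sub_eq_zero, ← map_sub, jet_eq_zero_iff]
  have hle : M i ≤ (idealOfVars (Fin 2) k).comap (locMap τ (Q i)) := by
    intro x hx
    rw [Ideal.mem_comap, mem_idealOfVars_iff_constCoeff, constCoeff_locMap]
    exact hx
  have := Ideal.pow_right_mono hle (N i) (hH i)
  exact Ideal.le_comap_pow _ _ this

/-- Homogenization keeps jets. -/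
theorem exists_homogenization {ι : Type} (τ : k) (Q : ι → Fin 3 → k)
    (hL : ∀ i, lval τ (Q i) = 1) (H : MvPolynomial (Fin 3) k) (d : ℕ) (hd : H.totalDegree ≤ d) :
    ∃ H' : MvPolynomial (Fin 3) k, H'.IsHomogeneous d ∧
      ∀ i, locMap τ (Q i) H' = locMap τ (Q i) H := by
  refine ⟨∑ j ∈ Finset.range (H.totalDegree + 1), lform τ ^ (d - j) * homogeneousComponent j H,
    ?_, ?_⟩
  · apply IsHomogeneous.sum
    intro j hj
    have h1 := ((lform_homog τ).pow (d - j)).mul (homogeneousComponent_isHomogeneous j H)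
    have : 1 * (d - j) + j = d := by
      have := Finset.mem_range.1 hj; omega
    rwa [this] at h1
  · intro i
    conv_rhs => rw [← sum_homogeneousComponent H]
    simp [map_sum, locMap_lform, hL]

theorem exists_degree_surjective {ι : Type} [Fintype ι] (τ : k) (Q : ι → Fin 3 → k)
    (hQ : Function.Injective Q) (hL : ∀ i, lval τ (Q i) = 1) (N : ι → ℕ) :
    ∃ D, ∀ d, D ≤ d → ∀ c : (∀ i, JIdx (N i) → k), ∃ H ∈ homogeneousSubmodule (Fin 3) k d,
      ∀ i, jet τ (Q i) (N i) H = c i := by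
  classical
  let V := ∀ i, JIdx (N i) → k
  let b := Module.finBasis k V
  choose H hH using fun c : V => jets_surjective_aux τ Q hQ N c
  refine ⟨Finset.univ.sup fun l => (H (b l)).totalDegree, fun d hd c => ?_⟩
  have h1 : ∀ l, ∃ H' : MvPolynomial (Fin 3) k, H'.IsHomogeneous d ∧
      ∀ i, locMap τ (Q i) H' = locMap τ (Q i) (H (b l)) := fun l =>
    exists_homogenization τ Q hL _ d
      ((Finset.le_sup (f := fun l => (H (b l)).totalDegree) (Finset.mem_univ l)).trans hd)
  choose H' hH' hH'' using h1
  refine ⟨∑ l, b.repr c l • H' l, ?_, ?_⟩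
  · exact Submodule.sum_mem _ fun l _ => Submodule.smul_mem _ _ (hH' l)
  · intro i
    have : ∀ l, jet τ (Q i) (N i) (H' l) = b l i := by
      intro l
      rw [← hH (b l) i]
      simp only [jet, LinearMap.comp_apply, AlgHom.toLinearMap_apply, hH'']
    simp only [map_sum, map_smul, this]
    have := congrFun (b.sum_repr c) i
    rw [Finset.sum_apply] at this
    exact this

theorem finrank_ker_comp_le {U V W : Type} [AddCommGroup U] [Module k U] [AddCommGroup V]
    [Module k V] [AddCommGroup W] [Module k W] [FiniteDimensional k U] [FiniteDimensional k V]
    (f : U →ₗ[k] V) (g : V →ₗ[k] W) :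
    Module.finrank k (LinearMap.ker (g ∘ₗ f)) ≤
      Module.finrank k (LinearMap.ker f) + Module.finrank k (LinearMap.ker g) := by
  let h : LinearMap.ker (g ∘ₗ f) →ₗ[k] LinearMap.ker g :=
    f.restrict (p := LinearMap.ker (g ∘ₗ f)) (q := LinearMap.ker g) (fun x hx => hx)
  have h1 := LinearMap.finrank_range_add_finrank_ker h
  have h2 : Module.finrank k (LinearMap.range h) ≤ Module.finrank k (LinearMap.ker g) :=
    Submodule.finrank_le _
  have h3 : Module.finrank k (LinearMap.ker h) ≤ Module.finrank k (LinearMap.ker f) := by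
    let j : LinearMap.ker h →ₗ[k] LinearMap.ker f :=
      LinearMap.codRestrict _ ((LinearMap.ker (g ∘ₗ f)).subtype ∘ₗ (LinearMap.ker h).subtype)
        (fun x => congrArg Subtype.val x.2)
    apply LinearMap.finrank_le_finrank_of_injective (f := j)
    intro x y hxy
    have := congrArg Subtype.val hxy
    exact Subtype.ext (Subtype.ext this)
  omega

theorem finrank_range_le_of_ker_le {U V W : Type} [AddCommGroup U] [Module k U] [AddCommGroup V]
    [Module k V] [AddCommGroup W] [Module k W] [FiniteDimensional k U] [FiniteDimensional k V]
    (f : U →ₗ[k] V) (g : U →ₗ[k] W) (h : LinearMap.ker f ≤ LinearMap.ker g) :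
    Module.finrank k (LinearMap.range g) ≤ Module.finrank k V := by
  have h1 := LinearMap.finrank_range_add_finrank_ker f
  have h2 := LinearMap.finrank_range_add_finrank_ker g
  have h3 := Submodule.finrank_mono h
  have h4 : Module.finrank k (LinearMap.range f) ≤ Module.finrank k V :=
    Submodule.finrank_le _
  omega

/-- The total jet map. -/
noncomputable def jets {ι : Type} [Fintype ι] (τ : k) (Q : ι → Fin 3 → k) (N : ι → ℕ) :
    MvPolynomial (Fin 3) k →ₗ[k] (∀ i, JIdx (N i) → k) :=
  LinearMap.pi fun i => jet τ (Q i) (N i)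

theorem jets_eq_zero_iff {ι : Type} [Fintype ι] (τ : k) (Q : ι → Fin 3 → k) (N : ι → ℕ)
    (H : MvPolynomial (Fin 3) k) :
    jets τ Q N H = 0 ↔ ∀ i, locMap τ (Q i) H ∈ idealOfVars (Fin 2) k ^ N i := by
  simp only [← jet_eq_zero_iff, funext_iff (f := jets τ Q N H)]
  rfl

theorem finrank_jets {ι : Type} [Fintype ι] (N : ι → ℕ) :
    2 * Module.finrank k (∀ i, JIdx (N i) → k) = ∑ i, N i * (N i + 1) := by
  rw [Module.finrank_pi_fintype, Finset.mul_sum]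
  refine Finset.sum_congr rfl fun i _ => ?_
  rw [Module.finrank_fintype_fun_eq_card, two_mul_card_jidx]

theorem eq_mul_homogeneousComponent (F c b : MvPolynomial (Fin 3) k) (n q : ℕ)
    (hF : F.IsHomogeneous n) (hb : b.IsHomogeneous (n + q)) (h : b = F * c) :
    b = F * homogeneousComponent q c := by
  have h1 : homogeneousComponent (n + q) (F * c) = F * homogeneousComponent q c := by
    conv_lhs => rw [← sum_homogeneousComponent c]
    rw [Finset.mul_sum, map_sum]
    have h2 : ∀ j, homogeneousComponent (n + q) (F * homogeneousComponent j c) =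
        if q = j then F * homogeneousComponent j c else 0 := by
      intro j
      rw [homogeneousComponent_of_mem (n := n + j)
        (hF.mul (homogeneousComponent_isHomogeneous j c))]
      simp
    simp only [h2]
    rw [Finset.sum_ite_eq]
    split_ifs with h3
    · rfl
    · rw [homogeneousComponent_eq_zero, mul_zero]
      simp at h3; omega
  rw [← h1, ← h, homogeneousComponent_eq_self hb]

theorem bezout {ι : Type} [Fintype ι] (τ : k) (Q : ι → Fin 3 → k)
    (hQ : Function.Injective Q) (hL : ∀ i, lval τ (Q i) = 1)
    (r s : ι → ℕ) (F G : MvPolynomial (Fin 3) k) (n e : ℕ) (hF : Irreducible F)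
    (hFh : F.IsHomogeneous n) (hGh : G.IsHomogeneous e) (hG : G ≠ 0) (hen : e < n)
    (hr : ∀ i, locMap τ (Q i) F ∈ idealOfVars (Fin 2) k ^ r i)
    (hs : ∀ i, locMap τ (Q i) G ∈ idealOfVars (Fin 2) k ^ s i) :
    ∑ i, r i * s i ≤ n * e := by
  obtain ⟨q, hq⟩ := exists_degree_surjective τ Q hQ hL (fun i => r i + s i)
  set d := n + e + q with hd
  replace hq := hq d (by omega)
  let A := homogeneousSubmodule (Fin 3) k (e + q)
  let B := homogeneousSubmodule (Fin 3) k (n + q)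
  let E := homogeneousSubmodule (Fin 3) k q
  let Sd := homogeneousSubmodule (Fin 3) k d
  let Φ : (A × B) →ₗ[k] Sd :=
    LinearMap.codRestrict Sd ((LinearMap.mulLeft k F ∘ₗ A.subtype).coprod
      (LinearMap.mulLeft k G ∘ₗ B.subtype)) (by
        rintro ⟨⟨a, ha⟩, ⟨b, hb⟩⟩
        refine Submodule.add_mem _ ?_ ?_
        · have : (F * a).IsHomogeneous (n + (e + q)) := hFh.mul ha
          rw [← add_assoc] at this
          exact this
        · have : (G * b).IsHomogeneous (e + (n + q)) := hGh.mul hb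
          rw [← add_assoc, add_comm e n] at this
          exact this)
  have hΦ : ∀ x, (Φ x : MvPolynomial (Fin 3) k) = F * x.1 + G * x.2 := fun x => rfl
  let ev : Sd →ₗ[k] (∀ i, JIdx (r i + s i) → k) := (jets τ Q fun i => r i + s i).domRestrict Sd
  have hev : Function.Surjective ev := by
    intro c
    obtain ⟨H, hH, h⟩ := hq c
    exact ⟨⟨H, hH⟩, funext h⟩
  have e1 := LinearMap.finrank_range_add_finrank_ker ev
  rw [LinearMap.range_eq_top.2 hev, finrank_top] at e1
  have e2 := LinearMap.finrank_range_add_finrank_ker (ev ∘ₗ Φ)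
  rw [Module.finrank_prod] at e2
  have e3 := finrank_ker_comp_le Φ ev
  -- the small jets
  let J : (A × B) →ₗ[k] ((∀ i, JIdx (s i) → k) × (∀ i, JIdx (r i) → k)) :=
    LinearMap.prodMap ((jets τ Q s).domRestrict A) ((jets τ Q r).domRestrict B)
  have e4 := finrank_range_le_of_ker_le J (ev ∘ₗ Φ) (by
    rintro ⟨a, b⟩ hab
    have h1 : jets τ Q s a.1 = 0 := congrArg Prod.fst hab
    have h2 : jets τ Q r b.1 = 0 := congrArg Prod.snd hab
    show jets τ Q (fun i => r i + s i) (F * a.1 + G * b.1) = 0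
    rw [jets_eq_zero_iff] at h1 h2 ⊢
    intro i
    rw [map_add, map_mul, map_mul, pow_add]
    refine Ideal.add_mem _ (Ideal.mul_mem_mul (hr i) (h1 i)) ?_
    rw [mul_comm (locMap τ (Q i) G)]
    exact Ideal.mul_mem_mul (h2 i) (hs i))
  rw [Module.finrank_prod] at e4
  -- the Koszul kernel
  have e5 : Module.finrank k (LinearMap.ker Φ) ≤ Module.finrank k E := by
    have hFG : ¬ F ∣ G := by
      rintro ⟨H, rfl⟩
      have hH : H ≠ 0 := right_ne_zero_of_mul hG
      have h1 := hGh.totalDegree hG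
      rw [totalDegree_mul_of_isDomain hF.ne_zero hH, hFh.totalDegree hF.ne_zero] at h1
      omega
    let pr : LinearMap.ker Φ →ₗ[k] B := LinearMap.snd k A B ∘ₗ (LinearMap.ker Φ).subtype
    let mF : E →ₗ[k] B := LinearMap.codRestrict B (LinearMap.mulLeft k F ∘ₗ E.subtype)
      (fun x => hFh.mul x.2)
    have hinj : Function.Injective pr := by
      rintro ⟨⟨a, b⟩, hab⟩ ⟨⟨a', b'⟩, hab'⟩ h
      have hb : b = b' := h
      have h1 : F * a.1 + G * b.1 = 0 := congrArg Subtype.val hab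
      have h2 : F * a'.1 + G * b'.1 = 0 := congrArg Subtype.val hab'
      subst hb
      have h3 : F * a.1 = F * a'.1 := by linear_combination h1 - h2
      have h4 : a = a' := Subtype.ext (mul_left_cancel₀ hF.ne_zero h3)
      subst h4
      rfl
    have hle : LinearMap.range pr ≤ LinearMap.range mF := by
      rintro _ ⟨⟨⟨a, b⟩, hab⟩, rfl⟩
      have h1 : F * a.1 + G * b.1 = 0 := congrArg Subtype.val hab
      have h2 : F ∣ G * b.1 := ⟨-a.1, by linear_combination h1⟩
      obtain ⟨c, hc⟩ := (hF.prime.dvd_or_dvd h2).resolve_left hFG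
      refine ⟨⟨homogeneousComponent q c, homogeneousComponent_isHomogeneous q c⟩, ?_⟩
      apply Subtype.ext
      show F * homogeneousComponent q c = b.1
      exact (eq_mul_homogeneousComponent F c b.1 n q hFh b.2 hc).symm
    calc Module.finrank k (LinearMap.ker Φ) = Module.finrank k (LinearMap.range pr) :=
          (LinearMap.finrank_range_of_inj hinj).symm
      _ ≤ Module.finrank k (LinearMap.range mF) := Submodule.finrank_mono hle
      _ ≤ Module.finrank k E := LinearMap.finrank_range_le _
  have f1 := finrank_jets (k := k) (fun i => r i + s i)
  have f2 := finrank_jets (k := k) r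
  have f3 := finrank_jets (k := k) s
  have g1 : 2 * Module.finrank k A = _ := finrank_homog (k := k) (e + q)
  have g2 : 2 * Module.finrank k B = _ := finrank_homog (k := k) (n + q)
  have g3 : 2 * Module.finrank k E = _ := finrank_homog (k := k) q
  have g4 : 2 * Module.finrank k Sd = _ := finrank_homog (k := k) d
  have hsum : ∑ i, (r i + s i) * (r i + s i + 1) =
      ∑ i, r i * (r i + 1) + ∑ i, s i * (s i + 1) + 2 * ∑ i, r i * s i := by
    rw [Finset.mul_sum, ← Finset.sum_add_distrib, ← Finset.sum_add_distrib]
    exact Finset.sum_congr rfl fun i _ => by ring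
  have hfin : (d + 1) * (d + 2) + (q + 1) * (q + 2) =
      (e + q + 1) * (e + q + 2) + (n + q + 1) * (n + q + 2) + 2 * (n * e) := by
    rw [hd]; ring
  omega

theorem exists_curve {ι : Type} [Fintype ι] (τ : k) (Q : ι → Fin 3 → k) (s : ι → ℕ) (e : ℕ)
    (h : ∑ i, s i * (s i + 1) < (e + 1) * (e + 2)) :
    ∃ G : MvPolynomial (Fin 3) k, G.IsHomogeneous e ∧ G ≠ 0 ∧
      ∀ i, locMap τ (Q i) G ∈ idealOfVars (Fin 2) k ^ s i := by
  have h1 := finrank_jets (k := k) s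
  have h2 := finrank_homog (k := k) e
  have h3 := LinearMap.ker_ne_bot_of_finrank_lt
    (f := (jets τ Q s).domRestrict (homogeneousSubmodule (Fin 3) k e)) (by omega)
  obtain ⟨x, hx, hx0⟩ := Submodule.exists_mem_ne_zero_of_ne_bot h3
  refine ⟨x.1, x.2, fun h => hx0 (Subtype.ext h), ?_⟩
  exact (jets_eq_zero_iff τ Q s x.1).1 hx

theorem eval_smul_of_homog {F : MvPolynomial (Fin 3) k} {n : ℕ} (hF : F.IsHomogeneous n)
    (c : k) (v : Fin 3 → k) : eval (c • v) F = c ^ n * eval v F := by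
  rw [eval_eq', eval_eq', Finset.mul_sum]
  refine Finset.sum_congr rfl fun x hx => ?_
  have h1 := hF.degree_eq_sum_deg_support hx
  simp only [Pi.smul_apply, smul_eq_mul, mul_pow, Finset.prod_mul_distrib]
  rw [Finset.prod_pow_eq_pow_sum, ← Finsupp.degree_eq_sum, show x.degree = n from h1.symm]
  ring

theorem exists_root_on_line [IsAlgClosed k] {F : MvPolynomial (Fin 3) k} {n : ℕ} (hn : 0 < n)
    (hF : F.IsHomogeneous n) (v : Fin 3 → k) (hv : eval v F ≠ 0) (w : Fin 3 → k) :
    ∃ b : k, eval (w + b • v) F = 0 := by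
  have : Infinite k := IsAlgClosed.instInfinite
  by_contra! hno
  let p : (Fin 3 → k) → (Fin 3 → k) → Polynomial k := fun a b =>
    aeval (fun j => Polynomial.C (a j) + Polynomial.X * Polynomial.C (b j)) F
  have hp : ∀ a b t, (p a b).eval t = eval (a + t • b) F := by
    intro a b t
    have : ((Polynomial.evalRingHom t).comp
        (aeval (fun j => Polynomial.C (a j) + Polynomial.X * Polynomial.C (b j)) :
          MvPolynomial (Fin 3) k →ₐ[k] Polynomial k).toRingHom) = eval (a + t • b) := by
      apply MvPolynomial.ringHom_ext
      · intro r; simp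
      · intro i; simp; ring
    exact congrArg (fun f => f F) this
  have hdeg : (p w v).degree = 0 := by
    by_contra h
    obtain ⟨x, hx⟩ := IsAlgClosed.exists_root (p w v) h
    exact hno x (by rw [← hp]; exact hx)
  obtain ⟨c, hc⟩ : ∃ c, p w v = Polynomial.C c := ⟨_, Polynomial.eq_C_of_degree_eq_zero hdeg⟩
  have hz : (p v w - Polynomial.C c * Polynomial.X ^ n) * Polynomial.X = 0 := by
    apply Polynomial.funext
    intro a
    by_cases ha : a = 0
    · simp [ha]
    · have h1 : v + a • w = a • (w + a⁻¹ • v) := by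
        rw [smul_add, smul_smul, mul_inv_cancel₀ ha, one_smul, add_comm]
      have h2 : eval (w + a⁻¹ • v) F = c := by rw [← hp, hc, Polynomial.eval_C]
      simp only [Polynomial.eval_mul, Polynomial.eval_sub, hp, h1, eval_smul_of_homog hF, h2,
        Polynomial.eval_C, Polynomial.eval_pow, Polynomial.eval_X, Polynomial.eval_zero]
      ring
  rcases mul_eq_zero.1 hz with h | h
  · have h3 := congrArg (Polynomial.eval 0) h
    simp only [Polynomial.eval_mul, Polynomial.eval_sub, hp, Polynomial.eval_C,
      Polynomial.eval_pow, Polynomial.eval_X, Polynomial.eval_zero, zero_pow hn.ne', mul_zero,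
      sub_zero, zero_smul, add_zero] at h3
    exact hv h3
  · exact Polynomial.X_ne_zero h

/-- There are arbitrarily many points on the curve, avoiding a given finite set. -/
theorem exists_points [IsAlgClosed k] (F : MvPolynomial (Fin 3) k) (n : ℕ) (hn : 0 < n)
    (hFh : F.IsHomogeneous n) (hF : F ≠ 0) (K : ℕ) (P : Fin K → Fin 3 → k)
    (hP : ∀ i, P i ≠ 0) (N : ℕ) :
    ∃ R : Fin N → Fin 3 → k, (∀ j, R j ≠ 0) ∧ (∀ j, eval (R j) F = 0) ∧
      (∀ i j, i ≠ j → ∀ c : k, R j ≠ c • R i) ∧ (∀ i j, ∀ c : k, R j ≠ c • P i) := by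
  have : Infinite k := IsAlgClosed.instInfinite
  obtain ⟨v, hv⟩ : ∃ v : Fin 3 → k, eval v (F * X 2) ≠ 0 := by
    by_contra! h
    exact mul_ne_zero hF (X_ne_zero 2) (MvPolynomial.funext (by simpa using h))
  rw [map_mul, eval_X] at hv
  have hv2 : v 2 ≠ 0 := right_ne_zero_of_mul hv
  have hvF : eval v F ≠ 0 := left_ne_zero_of_mul hv
  have key : ∀ w : Fin 3 → k, ∃ b : k, eval (w + b • v) F = 0 :=
    exists_root_on_line hn hFh v hvF
  choose b hb using key
  let w : k → Fin 3 → k := fun s => ![1, s, 0]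
  let R : k → Fin 3 → k := fun s => w s + b (w s) • v
  have hR : ∀ s, R s ≠ 0 := by
    intro s h
    have h2 : (0 : k) + b (w s) * v 2 = 0 := congrFun h 2
    have h0 : (1 : k) + b (w s) * v 0 = 0 := congrFun h 0
    simp [hv2] at h2
    simp [h2] at h0
  have hRinj : ∀ (s s' c : k), R s' = c • R s → s' = s := by
    intro s s' c h
    have h0 : (1 : k) + b (w s') * v 0 = c * (1 + b (w s) * v 0) := congrFun h 0
    have h1 : s' + b (w s') * v 1 = c * (s + b (w s) * v 1) := congrFun h 1
    have h2 : (0 : k) + b (w s') * v 2 = c * (0 + b (w s) * v 2) := congrFun h 2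
    have h3 : b (w s') = c * b (w s) := by
      apply mul_right_cancel₀ hv2
      linear_combination h2
    have hc : c = 1 := by linear_combination (-1) * h0 + v 0 * h3
    rw [hc] at h1 h3
    linear_combination h1 - v 1 * h3
  have hbad : ∀ i, {s : k | ∃ c : k, R s = c • P i}.Finite := by
    intro i
    apply Set.Subsingleton.finite
    rintro s ⟨c, hc⟩ s' ⟨c', hc'⟩
    have hc0 : c' ≠ 0 := by
      rintro rfl
      exact hR s' (by rw [hc', zero_smul])
    apply hRinj s' s (c * c'⁻¹)
    rw [hc, hc', smul_smul, mul_assoc, inv_mul_cancel₀ hc0, mul_one]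
  have hgood : (⋃ i, {s : k | ∃ c : k, R s = c • P i})ᶜ.Infinite :=
    (Set.finite_iUnion hbad).infinite_compl
  let em := hgood.natEmbedding
  refine ⟨fun j => R (em j), fun j => hR _, fun j => hb _, ?_, ?_⟩
  · intro i j hij c h
    have := hRinj _ _ _ h
    have := em.injective (Subtype.ext this)
    exact hij (Fin.ext this.symm)
  · intro i j c h
    have h1 := (em j).2
    apply h1
    exact Set.mem_iUnion.2 ⟨i, c, h⟩

theorem exists_tau [Infinite k] {ι : Type} [Fintype ι] (P : ι → Fin 3 → k) (hP : ∀ i, P i ≠ 0) :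
    ∃ τ : k, ∀ i, lval τ (P i) ≠ 0 := by
  classical
  let f : ι → Polynomial k := fun i => Polynomial.C (P i 2) + Polynomial.C (P i 1) * Polynomial.X +
    Polynomial.C (P i 0) * Polynomial.X ^ 2
  have hf : ∀ i, f i ≠ 0 := by
    intro i h
    apply hP i
    funext j
    fin_cases j
    · have := congrArg (Polynomial.coeff · 2) h
      simpa [f, Polynomial.coeff_X, Polynomial.coeff_C] using this
    · have := congrArg (Polynomial.coeff · 1) h
      simpa [f, Polynomial.coeff_X, Polynomial.coeff_C] using this
    · have := congrArg (Polynomial.coeff · 0) h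
      simpa [f, Polynomial.coeff_X, Polynomial.coeff_C] using this
  have hprod : ∏ i, f i ≠ 0 := Finset.prod_ne_zero_iff.2 fun i _ => hf i
  obtain ⟨τ, hτ⟩ : ∃ τ, (∏ i, f i).eval τ ≠ 0 := by
    by_contra! h
    exact hprod (Polynomial.funext (by simpa using h))
  refine ⟨τ, fun i => ?_⟩
  rw [Polynomial.eval_prod, Finset.prod_ne_zero_iff] at hτ
  have := hτ i (Finset.mem_univ i)
  simp only [f, Polynomial.eval_add, Polynomial.eval_mul, Polynomial.eval_C, Polynomial.eval_X,
    Polynomial.eval_pow] at this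
  unfold lval
  intro h
  apply this
  linear_combination h

theorem pderivList_homog {F : MvPolynomial (Fin 3) k} {n : ℕ} (hF : F.IsHomogeneous n)
    (s : List (Fin 3)) : (pderivList s F).IsHomogeneous (n - s.length) := by
  induction s with
  | nil => simpa [pderivList] using hF
  | cons i s ih =>
    have := ih.pderiv (i := i)
    rw [Nat.sub_sub] at this
    simpa [pderivList] using this

theorem vanish_smul {F : MvPolynomial (Fin 3) k} {n : ℕ} (hF : F.IsHomogeneous n)
    {v w : Fin 3 → k} {m : ℕ} (hw : ∃ c : k, w = c • v)
    (h : ∀ s : List (Fin 3), s.length < m → eval v (pderivList s F) = 0) :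
    ∀ s : List (Fin 3), s.length < m → eval w (pderivList s F) = 0 := by
  obtain ⟨c, rfl⟩ := hw
  intro s hs
  rw [eval_smul_of_homog (pderivList_homog hF s), h s hs, mul_zero]

theorem exists_config [IsAlgClosed k] (F : MvPolynomial (Fin 3) k) (n : ℕ) (hn : 0 < n)
    (hFh : F.IsHomogeneous n) (hF : F ≠ 0) (K : ℕ) (P : Fin K → Fin 3 → k)
    (hP : ∀ i, P i ≠ 0) (hdist : ∀ i j, i ≠ j → ¬ ∃ c : k, P j = c • P i) (N : ℕ) :
    ∃ (τ : k) (Q : Fin K ⊕ Fin N → Fin 3 → k), Function.Injective Q ∧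
      (∀ x, lval τ (Q x) = 1) ∧ (∀ i, ∃ c : k, Q (Sum.inl i) = c • P i) ∧
      ∀ j, eval (Q (Sum.inr j)) F = 0 := by
  have : Infinite k := IsAlgClosed.instInfinite
  obtain ⟨R, hR0, hRF, hRR, hRP⟩ := exists_points F n hn hFh hF K P hP N
  let P' : Fin K ⊕ Fin N → Fin 3 → k := Sum.elim P R
  have hP' : ∀ x, P' x ≠ 0 := by
    rintro (x | x)
    · exact hP x
    · exact hR0 x
  obtain ⟨τ, hτ⟩ := exists_tau P' hP'
  have hprop : ∀ x y, (lval τ (P' x))⁻¹ • P' x = (lval τ (P' y))⁻¹ • P' y →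
      ∃ c : k, P' x = c • P' y := by
    intro x y h
    refine ⟨lval τ (P' x) * (lval τ (P' y))⁻¹, ?_⟩
    rw [mul_smul, ← h, smul_smul, mul_inv_cancel₀ (hτ x), one_smul]
  refine ⟨τ, fun x => (lval τ (P' x))⁻¹ • P' x, ?_, ?_, ?_, ?_⟩
  · intro x y h
    obtain ⟨c, hc⟩ := hprop x y h
    obtain ⟨c', hc'⟩ := hprop y x h.symm
    rcases x with x | x <;> rcases y with y | y
    · by_contra hne
      exact hdist y x (fun h => hne (by rw [h])) ⟨c, hc⟩
    · exact absurd hc' (hRP x y c')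
    · exact absurd hc (hRP y x c)
    · by_contra hne
      exact hRR y x (fun h => hne (by rw [h])) c hc
  · intro x
    have h1 : ∀ (c : k) v, lval τ (c • v) = c * lval τ v := by
      intro c v; simp [lval]; ring
    simp only [h1]
    exact inv_mul_cancel₀ (hτ x)
  · intro i
    exact ⟨_, rfl⟩
  · intro j
    rw [eval_smul_of_homog hFh]
    show _ * eval (R j) F = 0
    rw [hRF, mul_zero]

/-- If an irreducible plane curve of degree `n` has singular points of
multiplicities `m 1, …, m K`, then `(n−1)(n−2)/2 − Σ mᵢ(mᵢ−1)/2 ≥ 0`, i.e.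
`Σ mᵢ(mᵢ−1) ≤ (n−1)(n−2)`. -/
theorem genus_bound_nonneg
    (k : Type) [Field k] [IsAlgClosed k] [CharZero k] (C : PlaneCurve k)
    (K : ℕ) (P : Fin K → (Fin 3 → k)) (m : Fin K → ℕ)
    -- the points are pairwise distinct in ℙ²
    (hdist : ∀ i j, i ≠ j → ¬ ∃ c : k, P j = c • P i)
    -- each is a singular point of C of multiplicity m i
    (hsing : ∀ i, IsSingularAt C.F (P i))
    (hmult : ∀ i, HasMultiplicityAt C.F (P i) (m i)) :
    ∑ i, m i * (m i - 1) ≤ (C.n - 1) * (C.n - 2) := by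
  have hn : 0 < C.n := by
    rcases Nat.eq_zero_or_pos C.n with h | h
    · exfalso
      have h1 := C.homog
      rw [h, ← totalDegree_zero_iff_isHomogeneous, totalDegree_eq_zero_iff_eq_C] at h1
      apply C.irred.not_isUnit
      rw [h1]
      apply IsUnit.map
      apply IsUnit.mk0
      intro h2
      rw [h2, map_zero] at h1
      exact C.irred.ne_zero h1
    · exact h
  obtain ⟨ν, hν⟩ : ∃ ν, C.n = ν + 1 := ⟨C.n - 1, by omega⟩
  have hP0 : ∀ i, P i ≠ 0 := fun i => (hsing i).1
  have hsum1 : ∀ i, (m i - 1) * (m i - 1 + 1) = m i * (m i - 1) := by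
    intro i
    rcases Nat.eq_zero_or_pos (m i) with h | h
    · simp [h]
    · rw [Nat.sub_add_cancel h, mul_comm]
  -- first bound
  have b1 : ∑ i, m i * (m i - 1) ≤ C.n * (C.n - 1) := by
    obtain ⟨τ, Q, hinj, hL, hQ1, hQ2⟩ :=
      exists_config C.F C.n hn C.homog C.irred.ne_zero K P hP0 hdist 0
    obtain ⟨i, hi⟩ : ∃ i, pderiv i C.F ≠ 0 := by
      by_contra! h
      have h1 := C.homog.sum_X_mul_pderiv
      simp only [h, mul_zero, Finset.sum_const_zero] at h1
      have h2 := smul_eq_zero.1 h1.symm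
      rcases h2 with h2 | h2
      · omega
      · exact C.irred.ne_zero h2
    have := bezout τ Q hinj hL (Sum.elim m fun _ => 1) (Sum.elim (fun i => m i - 1) fun _ => 0)
      C.F (pderiv i C.F) C.n (C.n - 1) C.irred C.homog C.homog.pderiv hi (by omega)
      (fun x => by
        rcases x with x | x
        · exact locMap_mem_pow τ _ _ _ (vanish_smul C.homog (hQ1 x) (hmult x).1)
        · exact x.elim0)
      (fun x => by
        rcases x with x | x
        · apply locMap_mem_pow τ
          intro s hs
          have := vanish_smul C.homog (hQ1 x) (hmult x).1 (s ++ [i])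
            (by simp only [Sum.elim_inl] at hs; simp; omega)
          simpa [pderivList, List.foldr_append] using this
        · exact x.elim0)
    simpa [Fintype.sum_sum_type] using this
  -- the adjoint-type curve
  have j1 := finrank_jets (k := k) (fun i => m i - 1)
  simp only [hsum1] at j1
  have j2 := finrank_homog (k := k) ν
  set σ := Module.finrank k (∀ i, JIdx (m i - 1) → k) with hσ
  set D := Module.finrank k (homogeneousSubmodule (Fin 3) k ν) with hD
  rw [← j1, hν] at b1 ⊢
  simp only [Nat.add_sub_cancel] at b1 ⊢
  have hσD : σ + 1 ≤ D := by nlinarith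
  obtain ⟨t, ht⟩ := exists_add_of_le hσD
  obtain ⟨τ, Q, hinj, hL, hQ1, hQ2⟩ :=
    exists_config C.F C.n hn C.homog C.irred.ne_zero K P hP0 hdist t
  obtain ⟨G, hG1, hG2, hG3⟩ := exists_curve τ Q (Sum.elim (fun i => m i - 1) fun _ => 1) ν (by
    simp only [Fintype.sum_sum_type, Sum.elim_inl, Sum.elim_inr, hsum1, Finset.sum_const,
      Finset.card_univ, Fintype.card_fin, smul_eq_mul]
    omega)
  have b2 := bezout τ Q hinj hL (Sum.elim m fun _ => 1) (Sum.elim (fun i => m i - 1) fun _ => 1)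
      C.F G C.n ν C.irred C.homog hG1 hG2 (by omega)
      (fun x => by
        rcases x with x | x
        · exact locMap_mem_pow τ _ _ _ (vanish_smul C.homog (hQ1 x) (hmult x).1)
        · apply locMap_mem_pow τ
          intro s hs
          have hs0 : s = [] := List.length_eq_zero_iff.1 (by simpa using hs)
          subst hs0
          exact hQ2 x) hG3
  simp only [Fintype.sum_sum_type, Sum.elim_inl, Sum.elim_inr, Finset.sum_const,
      Finset.card_univ, Fintype.card_fin, smul_eq_mul, ← j1, hν] at b2
  rcases ν with _ | μ
  · simp at b1 ⊢
    omega
  · simp only [Nat.add_sub_cancel, show μ + 1 + 1 - 2 = μ by omega]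
    nlinarith
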